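/- arXiv:1001.0377 — 2 statements merged into one kernel-verified Lean document; each statement's English description precedes it below -/
import Mathlib

section
/- Let p > 1 and q > 1, and let sin_{pq} : ℝ → ℝ be the extended generalized sine function. Then u = sin_{pq} satisfies the equation (φ_p(u'))' + (q/p*)·φ_q(u) = 0 at every point of ℝ in the classical sense; that is, u is differentiable on ℝ, the function t ↦ φ_p(u'(t)) is differentiable on ℝ (including at the points t = nπ_{pq}/2, n ∈ ℤ), and its derivative equals −(q/p*)·φ_q(u(t)) for every t ∈ ℝ. -/
open Real Set Filter MeasureTheory

/-- Generalized arcsine: `arcsin_{pq}(σ) = ∫_0^σ (1 - s^q)^(-1/p) ds`. -/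
noncomputable def arcsinPQ (p q σ : ℝ) : ℝ :=
  ∫ s in (0:ℝ)..σ, (1 - s ^ q) ^ (-(1 / p))

/-- The generalized half-period `π_{pq} = 2 arcsin_{pq}(1)`. -/
noncomputable def piPQ (p q : ℝ) : ℝ := 2 * arcsinPQ p q 1

/-- Generalized incomplete elliptic integral:
`arcsn_{pq}(σ,k) = ∫_0^σ ((1-s^q)(1-k^q s^q))^(-1/p) ds`. -/
noncomputable def arcsnPQ (p q k σ : ℝ) : ℝ :=
  ∫ s in (0:ℝ)..σ, ((1 - s ^ q) * (1 - k ^ q * s ^ q)) ^ (-(1 / p))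

/-- Generalized complete elliptic integral `K_{pq}(k) = arcsn_{pq}(1,k)`. -/
noncomputable def Kpq (p q k : ℝ) : ℝ := arcsnPQ p q k 1

/-- `φ_m(s) = |s|^(m-2) s` for `s ≠ 0`, `φ_m(0) = 0`. -/
noncomputable def phi (m s : ℝ) : ℝ := if s = 0 then 0 else |s| ^ (m - 2) * s

/-- Incomplete beta function `B̃(a,b,u) = ∫_0^u z^(a-1) (1-z)^(b-1) dz`. -/
noncomputable def incBeta (a b u : ℝ) : ℝ :=
  ∫ z in (0:ℝ)..u, z ^ (a - 1) * (1 - z) ^ (b - 1)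

/-- A classical solution of `(φ_p(u'))' + λ φ_q(u) = 0` on `(0,T)` with
`u(0) = u(T) = 0`: `u ∈ C¹([0,T])`, `t ↦ φ_p(u'(t))` is differentiable on `(0,T)`
and the equation holds at every point of `(0,T)`. -/
def IsSolE (p q T lam : ℝ) (u : ℝ → ℝ) : Prop :=
  ∃ u' : ℝ → ℝ,
    (∀ t ∈ Set.Icc 0 T, HasDerivWithinAt u (u' t) (Set.Icc 0 T) t) ∧
    ContinuousOn u' (Set.Icc 0 T) ∧
    (∀ t ∈ Set.Ioo 0 T, HasDerivWithinAt (fun s => phi p (u' s))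
      (-(lam * phi q (u t))) (Set.Ioo 0 T) t) ∧
    u 0 = 0 ∧ u T = 0

/-- A classical solution of `(φ_p(u'))' + λ φ_q(u)(1 - |u|^q) = 0` on `(0,T)` with
`u(0) = u(T) = 0`. -/
def IsSolP (p q T lam : ℝ) (u : ℝ → ℝ) : Prop :=
  ∃ u' : ℝ → ℝ,
    (∀ t ∈ Set.Icc 0 T, HasDerivWithinAt u (u' t) (Set.Icc 0 T) t) ∧
    ContinuousOn u' (Set.Icc 0 T) ∧
    (∀ t ∈ Set.Ioo 0 T, HasDerivWithinAt (fun s => phi p (u' s))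
      (-(lam * phi q (u t) * (1 - |u t| ^ q))) (Set.Ioo 0 T) t) ∧
    u 0 = 0 ∧ u T = 0

/-- `Φ(k) = (1+k^q)^(1/p) (2k^q/(1+k^q))^(1/q - 1/p) K_{pq}(k)`. -/
noncomputable def PhiFun (p q k : ℝ) : ℝ :=
  (1 + k ^ q) ^ (1 / p) * (2 * k ^ q / (1 + k ^ q)) ^ (1 / q - 1 / p) * Kpq p q k

theorem phi_of_nonneg {m x : ℝ} (hm : 1 < m) (hx : 0 ≤ x) : phi m x = x ^ (m - 1) := by
  rcases hx.eq_or_lt with rfl | h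
  · simp [phi, Real.zero_rpow (sub_pos.2 hm).ne']
  · rw [phi, if_neg h.ne', abs_of_pos h, show m - 1 = m - 2 + 1 by ring, Real.rpow_add_one h.ne']

theorem phi_neg (m x : ℝ) : phi m (-x) = -phi m x := by
  by_cases h : x = 0 <;> simp [phi, h]

/-- Reflecting `f` at `c / 2` transports derivatives. -/
theorem HasDerivWithinAt.of_reflect {f : ℝ → ℝ} {a c e k t : ℝ} {s : Set ℝ}
    (hf : HasDerivWithinAt f a s t) (h : ∀ x, f x = k + e * f (c - x)) :
    HasDerivWithinAt f (-(e * a)) ((fun x => c - x) ⁻¹' s) (c - t) := by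
  have h1 : HasDerivWithinAt (fun x : ℝ => c - x) (-1) ((fun x => c - x) ⁻¹' s) (c - t) :=
    ((hasDerivAt_id (c - t)).const_sub c).hasDerivWithinAt
  have h2 : HasDerivWithinAt f a s (c - (c - t)) := by rwa [sub_sub_cancel]
  have h3 := ((h2.comp (c - t) h1 (fun x hx => hx)).const_mul e).const_add k
  have h4 : f = fun x => k + e * (f ∘ fun x => c - x) x := funext h
  rw [h4]
  exact h3.congr_deriv (by ring)

theorem HasDerivAt.of_reflect {f : ℝ → ℝ} {a c e t : ℝ}
    (hf : HasDerivAt f a t) (h : ∀ x, f x = e * f (c - x)) :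
    HasDerivAt f (-(e * a)) (c - t) := by
  have := hf.hasDerivWithinAt (s := univ) |>.of_reflect (k := 0) (c := c) (e := e) (by simpa using h)
  simpa [hasDerivWithinAt_univ] using this

/-- A one-sided derivative at a centre of symmetry of `f` that is compatible with the symmetry
is a two-sided derivative. -/
theorem HasDerivWithinAt.hasDerivAt_of_reflect {f : ℝ → ℝ} {a c e k : ℝ} {s : Set ℝ}
    (hf : HasDerivWithinAt f a s c) (h : ∀ x, f x = k + e * f (2 * c - x)) (hea : -(e * a) = a)
    (hs : ∀ x, x ∈ s ∨ 2 * c - x ∈ s) : HasDerivAt f a c := by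
  have h1 := hf.of_reflect h
  rw [hea, show 2 * c - c = c by ring] at h1
  have h2 := hf.union h1
  rwa [show s ∪ (fun x => 2 * c - x) ⁻¹' s = univ from eq_univ_of_forall hs,
    hasDerivWithinAt_univ] at h2

theorem hasDerivWithinAt_endpoints {f g : ℝ → ℝ} {a b : ℝ} (hab : a < b)
    (hf : ContinuousOn f (Icc a b)) (hg : ContinuousOn g (Icc a b))
    (hfg : ∀ t ∈ Ioo a b, HasDerivAt f (g t) t) :
    HasDerivWithinAt f (g a) (Ici a) a ∧ HasDerivWithinAt f (g b) (Iic b) b := by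
  have hd : DifferentiableOn ℝ f (Ioo a b) := fun t ht =>
    (hfg t ht).differentiableAt.differentiableWithinAt
  have heq : EqOn g (fun x => deriv f x) (Ioo a b) := fun t ht => (hfg t ht).deriv.symm
  constructor
  · have hl : a ∈ Icc a b := left_mem_Icc.2 hab.le
    refine hasDerivWithinAt_Ici_of_tendsto_deriv hd ((hf a hl).mono Ioo_subset_Icc_self)
      (Ioo_mem_nhdsGT hab) ?_
    rw [← nhdsWithin_Ioo_eq_nhdsGT hab]
    exact ((hg a hl).mono Ioo_subset_Icc_self).tendsto.congr' (heq.eventuallyEq_nhdsWithin)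
  · have hl : b ∈ Icc a b := right_mem_Icc.2 hab.le
    refine hasDerivWithinAt_Iic_of_tendsto_deriv hd ((hf b hl).mono Ioo_subset_Icc_self)
      (Ioo_mem_nhdsLT hab) ?_
    rw [← nhdsWithin_Ioo_eq_nhdsLT hab]
    exact ((hg b hl).mono Ioo_subset_Icc_self).tendsto.congr' (heq.eventuallyEq_nhdsWithin)

section arcsinPQ

variable {p q : ℝ}

theorem measurable_arcsinPQ_integrand (p q : ℝ) :
    Measurable fun s : ℝ => (1 - s ^ q) ^ (-(1 / p)) := by
  fun_prop

theorem one_sub_rpow_pos (hq : 1 < q) {s : ℝ} (h0 : 0 ≤ s) (h1 : s < 1) : 0 < 1 - s ^ q :=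
  sub_pos.2 (Real.rpow_lt_one h0 h1 (by linarith))

theorem intervalIntegrable_arcsinPQ_integrand (hp : 1 < p) (hq : 1 < q) :
    IntervalIntegrable (fun s : ℝ => (1 - s ^ q) ^ (-(1 / p))) volume 0 1 := by
  have hp' : 1 / p < 1 := (div_lt_one (by linarith)).2 hp
  have hp0 : 0 < 1 / p := by positivity
  have h1 : IntervalIntegrable (fun s : ℝ => (1 - s) ^ (-(1 / p))) volume 0 1 := by
    have := (intervalIntegral.intervalIntegrable_rpow' (a := 0) (b := 1)
      (r := -(1 / p)) (by linarith)).comp_sub_left 1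
    simpa using this.symm
  refine h1.mono_fun' (measurable_arcsinPQ_integrand p q).aestronglyMeasurable ?_
  rw [uIoc_of_le zero_le_one]
  filter_upwards [ae_restrict_mem measurableSet_Ioc] with s hs
  rcases hs.2.eq_or_lt with rfl | hs1
  · simp [abs_of_nonneg (Real.rpow_nonneg le_rfl _)]
  have hpos := one_sub_rpow_pos hq hs.1.le hs1
  rw [Real.norm_of_nonneg (Real.rpow_nonneg hpos.le _)]
  refine Real.rpow_le_rpow_of_nonpos (by linarith) ?_ (by linarith)
  have := Real.rpow_le_rpow_of_exponent_ge hs.1 hs1.le hq.le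
  rw [Real.rpow_one] at this
  linarith

theorem intervalIntegrable_arcsinPQ_integrand_of_mem (hp : 1 < p) (hq : 1 < q) {x y : ℝ}
    (hx : x ∈ Icc (0 : ℝ) 1) (hy : y ∈ Icc (0 : ℝ) 1) :
    IntervalIntegrable (fun s : ℝ => (1 - s ^ q) ^ (-(1 / p))) volume x y := by
  refine (intervalIntegrable_arcsinPQ_integrand hp hq).mono_set ?_
  rw [uIcc_of_le (zero_le_one (α := ℝ))]
  exact uIcc_subset_Icc hx hy

theorem continuousOn_arcsinPQ (hp : 1 < p) (hq : 1 < q) :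
    ContinuousOn (arcsinPQ p q) (Icc 0 1) := by
  have := intervalIntegral.continuousOn_primitive_interval
    (intervalIntegrable_iff_integrableOn_Icc_of_le (zero_le_one (α := ℝ)) |>.1
      (intervalIntegrable_arcsinPQ_integrand hp hq) |> fun h => by
        rwa [← uIcc_of_le (zero_le_one (α := ℝ))] at h)
  rwa [uIcc_of_le (zero_le_one (α := ℝ))] at this

theorem sub_le_arcsinPQ_sub (hp : 1 < p) (hq : 1 < q) {x y : ℝ}
    (hx : x ∈ Icc (0 : ℝ) 1) (hy : y ∈ Icc (0 : ℝ) 1) (hxy : x ≤ y) :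
    y - x ≤ arcsinPQ p q y - arcsinPQ p q x := by
  have h0 : (0 : ℝ) ∈ Icc (0 : ℝ) 1 := by simp
  unfold arcsinPQ
  rw [intervalIntegral.integral_interval_sub_left
    (intervalIntegrable_arcsinPQ_integrand_of_mem hp hq h0 hy)
    (intervalIntegrable_arcsinPQ_integrand_of_mem hp hq h0 hx)]
  have hp0 : 0 < 1 / p := by positivity
  calc y - x = ∫ _ in x..y, (1 : ℝ) := by simp
    _ ≤ _ := by
      refine intervalIntegral.integral_mono_on_of_le_Ioo hxy intervalIntegrable_const
        (intervalIntegrable_arcsinPQ_integrand_of_mem hp hq hx hy) fun s hs => ?_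
      have hs0 : 0 ≤ s := hx.1.trans hs.1.le
      refine Real.one_le_rpow_of_pos_of_le_one_of_nonpos
        (one_sub_rpow_pos hq hs0 (hs.2.trans_le hy.2)) ?_ (by linarith)
      linarith [Real.rpow_nonneg hs0 q]

theorem hasDerivAt_arcsinPQ (hp : 1 < p) (hq : 1 < q) {x : ℝ} (hx : x ∈ Ioo (0 : ℝ) 1) :
    HasDerivAt (arcsinPQ p q) ((1 - x ^ q) ^ (-(1 / p))) x := by
  refine intervalIntegral.integral_hasDerivAt_right
    (intervalIntegrable_arcsinPQ_integrand_of_mem hp hq (by simp) (Ioo_subset_Icc_self hx))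
    (measurable_arcsinPQ_integrand p q).stronglyMeasurable.stronglyMeasurableAtFilter ?_
  refine ContinuousAt.rpow_const ?_ (Or.inl (one_sub_rpow_pos hq hx.1.le hx.2).ne')
  exact continuousAt_const.sub (Real.continuousAt_rpow_const x q (Or.inl hx.1.ne'))

theorem arcsinPQ_zero (p q : ℝ) : arcsinPQ p q 0 = 0 := by simp [arcsinPQ]

theorem arcsinPQ_one (p q : ℝ) : arcsinPQ p q 1 = piPQ p q / 2 := by simp [piPQ]

theorem piPQ_pos (hp : 1 < p) (hq : 1 < q) : 0 < piPQ p q := by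
  have := sub_le_arcsinPQ_sub hp hq (x := 0) (y := 1) (by simp) (by simp) zero_le_one
  rw [arcsinPQ_zero, arcsinPQ_one] at this
  linarith

theorem exists_arcsinPQ_eq (hp : 1 < p) (hq : 1 < q) {t : ℝ} (ht : t ∈ Icc 0 (piPQ p q / 2)) :
    ∃ σ ∈ Icc (0 : ℝ) 1, arcsinPQ p q σ = t := by
  have := intermediate_value_Icc zero_le_one (continuousOn_arcsinPQ hp hq)
  rw [arcsinPQ_zero, arcsinPQ_one] at this
  exact this ht

end arcsinPQ

section inverse

variable {p q : ℝ} {S : ℝ → ℝ}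

theorem mem_Icc_and_arcsinPQ_eq (hp : 1 < p) (hq : 1 < q)
    (hinv : ∀ σ ∈ Icc (0 : ℝ) 1, S (arcsinPQ p q σ) = σ) {t : ℝ}
    (ht : t ∈ Icc 0 (piPQ p q / 2)) : S t ∈ Icc (0 : ℝ) 1 ∧ arcsinPQ p q (S t) = t := by
  obtain ⟨σ, hσ, rfl⟩ := exists_arcsinPQ_eq hp hq ht
  rw [hinv σ hσ]
  exact ⟨hσ, rfl⟩

theorem mem_Ioo_of_mem_Ioo (hp : 1 < p) (hq : 1 < q)
    (hinv : ∀ σ ∈ Icc (0 : ℝ) 1, S (arcsinPQ p q σ) = σ) {t : ℝ}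
    (ht : t ∈ Ioo 0 (piPQ p q / 2)) : S t ∈ Ioo (0 : ℝ) 1 := by
  obtain ⟨h1, h2⟩ := mem_Icc_and_arcsinPQ_eq hp hq hinv (Ioo_subset_Icc_self ht)
  refine ⟨h1.1.lt_of_ne fun h => ?_, h1.2.lt_of_ne fun h => ?_⟩
  · rw [← h, arcsinPQ_zero] at h2
    exact ht.1.ne h2
  · rw [h, arcsinPQ_one] at h2
    exact ht.2.ne' h2

theorem continuousOn_of_arcsinPQ_inverse (hp : 1 < p) (hq : 1 < q)
    (hinv : ∀ σ ∈ Icc (0 : ℝ) 1, S (arcsinPQ p q σ) = σ) :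
    ContinuousOn S (Icc 0 (piPQ p q / 2)) := by
  refine (LipschitzOnWith.of_dist_le_mul (K := 1) fun x hx y hy => ?_).continuousOn
  obtain ⟨hx1, hx2⟩ := mem_Icc_and_arcsinPQ_eq hp hq hinv hx
  obtain ⟨hy1, hy2⟩ := mem_Icc_and_arcsinPQ_eq hp hq hinv hy
  rw [Real.dist_eq, Real.dist_eq, NNReal.coe_one, one_mul]
  rcases le_total (S x) (S y) with h | h
  · have := sub_le_arcsinPQ_sub hp hq hx1 hy1 h
    rw [hx2, hy2] at this
    rw [abs_sub_comm, abs_of_nonneg (sub_nonneg.2 h), abs_sub_comm]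
    exact this.trans (le_abs_self _)
  · have := sub_le_arcsinPQ_sub hp hq hy1 hx1 h
    rw [hx2, hy2] at this
    rw [abs_of_nonneg (sub_nonneg.2 h)]
    exact this.trans (le_abs_self _)

theorem hasDerivAt_of_arcsinPQ_inverse (hp : 1 < p) (hq : 1 < q)
    (hinv : ∀ σ ∈ Icc (0 : ℝ) 1, S (arcsinPQ p q σ) = σ) {t : ℝ}
    (ht : t ∈ Ioo 0 (piPQ p q / 2)) : HasDerivAt S ((1 - S t ^ q) ^ (1 / p)) t := by
  have hS := mem_Ioo_of_mem_Ioo hp hq hinv ht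
  have hpos := one_sub_rpow_pos hq hS.1.le hS.2
  have h := HasDerivAt.of_local_left_inverse
    ((continuousOn_of_arcsinPQ_inverse hp hq hinv).continuousAt (Icc_mem_nhds ht.1 ht.2))
    (hasDerivAt_arcsinPQ hp hq hS) (Real.rpow_pos_of_pos hpos _).ne'
    (Filter.mem_of_superset (Icc_mem_nhds ht.1 ht.2) fun y hy =>
      (mem_Icc_and_arcsinPQ_eq hp hq hinv hy).2)
  rwa [Real.rpow_neg hpos.le, inv_inv] at h

theorem continuousOn_one_sub_rpow_rpow (hp : 1 < p) (hq : 1 < q)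
    (hinv : ∀ σ ∈ Icc (0 : ℝ) 1, S (arcsinPQ p q σ) = σ) {r : ℝ} (hr : 0 ≤ r) :
    ContinuousOn (fun t => (1 - S t ^ q) ^ r) (Icc 0 (piPQ p q / 2)) :=
  (continuousOn_const.sub ((continuousOn_of_arcsinPQ_inverse hp hq hinv).rpow_const
    fun _ _ => Or.inr (by linarith))).rpow_const fun _ _ => Or.inr hr

theorem hasDerivAt_one_sub_rpow_rpow (hp : 1 < p) (hq : 1 < q)
    (hinv : ∀ σ ∈ Icc (0 : ℝ) 1, S (arcsinPQ p q σ) = σ) {t : ℝ}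
    (ht : t ∈ Ioo 0 (piPQ p q / 2)) :
    HasDerivAt (fun t => (1 - S t ^ q) ^ ((p - 1) / p)) (-(q / (p / (p - 1)) * S t ^ (q - 1)))
      t := by
  have hS := mem_Ioo_of_mem_Ioo hp hq hinv ht
  have hpos := one_sub_rpow_pos hq hS.1.le hS.2
  have h := (((hasDerivAt_of_arcsinPQ_inverse hp hq hinv ht).rpow_const (p := q)
    (Or.inl hS.1.ne')).const_sub 1).rpow_const (p := (p - 1) / p) (Or.inl hpos.ne')
  refine h.congr_deriv ?_
  have hp0 : p ≠ 0 := by linarith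
  have hp1 : p - 1 ≠ 0 := by linarith
  have he : (p - 1) / p - 1 = -(1 / p) := by field_simp; ring
  have hm : (1 - S t ^ q) ^ (1 / p) ≠ 0 := (Real.rpow_pos_of_pos hpos _).ne'
  rw [he, Real.rpow_neg hpos.le]
  field_simp

end inverse

/-- The reflection `t ↦ π_{pq} - t` fixes the extended sine on the whole line. -/
theorem apply_eq_apply_sub {c : ℝ} (hc : 0 < c) {S : ℝ → ℝ}
    (hrefl : ∀ t ∈ Icc (c / 2) c, S t = S (c - t))
    (hodd : ∀ t : ℝ, S (-t) = -S t) (hper : ∀ t : ℝ, S (t + 2 * c) = S t) (t : ℝ) :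
    S t = S (c - t) := by
  have h1 : ∀ t ∈ Icc 0 c, S t = S (c - t) := fun t ht => by
    rcases le_total (c / 2) t with h | h
    · exact hrefl t ⟨h, ht.2⟩
    · have := hrefl (c - t) ⟨by linarith, by linarith [ht.1]⟩
      rw [this, sub_sub_cancel]
  have hP : Function.Periodic (fun t => S t = S (c - t)) (2 * c) := fun t => by
    have h2 := hper (c - (t + 2 * c))
    rw [show c - (t + 2 * c) + 2 * c = c - t by ring] at h2
    simp only [hper t, h2]
  obtain ⟨y, hy, h⟩ := hP.exists_mem_Ico (by linarith) t (-c)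
  refine h.mpr ?_
  rcases le_total 0 y with h0 | h0
  · exact h1 y ⟨h0, by linarith [hy.2]⟩
  · have h2 := h1 (y + c) ⟨by linarith [hy.1], by linarith⟩
    have h3 := hper (-(y + c))
    rw [show c - (y + c) = -y by ring, hodd] at h2
    rw [show -(y + c) + 2 * c = c - y by ring, hodd] at h3
    linarith

theorem stmt3 (p q : ℝ) (hp : 1 < p) (hq : 1 < q)
    (sinpq : ℝ → ℝ)
    (hinv : ∀ σ ∈ Icc (0:ℝ) 1, sinpq (arcsinPQ p q σ) = σ)
    (hrefl : ∀ t ∈ Icc (piPQ p q / 2) (piPQ p q), sinpq t = sinpq (piPQ p q - t))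
    (hodd : ∀ t : ℝ, sinpq (-t) = - sinpq t)
    (hper : ∀ t : ℝ, sinpq (t + 2 * piPQ p q) = sinpq t) :
    ∃ u' : ℝ → ℝ, (∀ t : ℝ, HasDerivAt sinpq (u' t) t) ∧
      ∀ t : ℝ, HasDerivAt (fun s => phi p (u' s))
        (-(q / (p / (p - 1)) * phi q (sinpq t))) t := by
  have hpi := piPQ_pos hp hq
  have hL : 0 < piPQ p q / 2 := by linarith
  have hr : 0 ≤ (p - 1) / p := div_nonneg (by linarith) (by linarith)
  have href := apply_eq_apply_sub hpi hrefl hodd hper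
  have hS0 : sinpq 0 = 0 := by simpa [arcsinPQ_zero] using hinv 0 (by simp)
  have hSL : sinpq (piPQ p q / 2) = 1 := by simpa [arcsinPQ_one] using hinv 1 (by simp)
  have hodd' : ∀ t, sinpq t = -1 * sinpq (0 - t) := fun t => by simp [hodd]
  have href' : ∀ t, sinpq t = 1 * sinpq (piPQ p q - t) := fun t => by rw [one_mul, ← href]
  have hcont := continuousOn_of_arcsinPQ_inverse hp hq hinv
  have hdS : ∀ t ∈ Icc 0 (piPQ p q / 2),
      HasDerivAt sinpq ((1 - sinpq t ^ q) ^ (1 / p)) t := by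
    obtain ⟨hl, hu⟩ := hasDerivWithinAt_endpoints hL hcont
      (continuousOn_one_sub_rpow_rpow hp hq hinv (r := 1 / p) (by positivity))
      fun t ht => hasDerivAt_of_arcsinPQ_inverse hp hq hinv ht
    intro t ht
    rcases ht.1.eq_or_lt with rfl | h0
    · refine hl.hasDerivAt_of_reflect (k := 0) (e := -1) (by simpa using hodd') (by ring) ?_
      intro x
      simpa using le_total 0 x
    rcases ht.2.eq_or_lt with rfl | h1
    · refine hu.hasDerivAt_of_reflect (k := 0) (e := 1) (fun x => ?_) ?_ fun x => ?_
      · rw [zero_add, mul_div_cancel₀ _ two_ne_zero, ← href']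
      · have : (1 / p) ≠ 0 := by positivity
        rw [hSL, Real.one_rpow, sub_self, Real.zero_rpow this]
        simp
      · simp only [mem_Iic]
        rcases le_total x (piPQ p q / 2) with h | h
        · exact Or.inl h
        · exact Or.inr (by linarith)
    · exact hasDerivAt_of_arcsinPQ_inverse hp hq hinv ⟨h0, h1⟩
  have heven : ∀ t, phi p (deriv sinpq t) = 1 * phi p (deriv sinpq (0 - t)) := fun t => by
    have h : (fun x => sinpq (0 - x)) = fun x => -sinpq x := by simp [hodd]
    have h2 := deriv_comp_const_sub sinpq (0 : ℝ) t
    rw [h, deriv.fun_neg, neg_inj] at h2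
    rw [h2, one_mul]
  have hanti : ∀ t, phi p (deriv sinpq t) = -1 * phi p (deriv sinpq (piPQ p q - t)) := fun t => by
    have h : (fun x => sinpq (piPQ p q - x)) = sinpq := funext fun x => (href x).symm
    have h2 := deriv_comp_const_sub sinpq (piPQ p q) t
    rw [h] at h2
    rw [h2, phi_neg, neg_one_mul]
  have hphi : ∀ t ∈ Icc 0 (piPQ p q / 2),
      phi p (deriv sinpq t) = (1 - sinpq t ^ q) ^ ((p - 1) / p) := fun t ht => by
    have hmem := (mem_Icc_and_arcsinPQ_eq hp hq hinv ht).1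
    have hnn : 0 ≤ 1 - sinpq t ^ q :=
      sub_nonneg.2 (Real.rpow_le_one hmem.1 hmem.2 (by linarith))
    rw [(hdS t ht).deriv, phi_of_nonneg hp (Real.rpow_nonneg hnn _), ← Real.rpow_mul hnn,
      one_div_mul_eq_div]
  have hphiq : ∀ t ∈ Icc 0 (piPQ p q / 2), phi q (sinpq t) = sinpq t ^ (q - 1) := fun t ht =>
    phi_of_nonneg hq (mem_Icc_and_arcsinPQ_eq hp hq hinv ht).1.1
  have hdI : ∀ t ∈ Ioo 0 (piPQ p q / 2), HasDerivAt (fun s => phi p (deriv sinpq s))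
      (-(q / (p / (p - 1)) * sinpq t ^ (q - 1))) t := fun t ht =>
    (hasDerivAt_one_sub_rpow_rpow hp hq hinv ht).congr_of_eventuallyEq
      (Filter.mem_of_superset (Icc_mem_nhds ht.1 ht.2) hphi)
  have hdP : ∀ t ∈ Icc 0 (piPQ p q / 2), HasDerivAt (fun s => phi p (deriv sinpq s))
      (-(q / (p / (p - 1)) * phi q (sinpq t))) t := by
    obtain ⟨hl, hu⟩ := hasDerivWithinAt_endpoints hL
      ((continuousOn_one_sub_rpow_rpow hp hq hinv hr).congr hphi)
      ((continuousOn_const.mul (hcont.rpow_const fun _ _ => Or.inr (by linarith))).neg) hdI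
    intro t ht
    rw [hphiq t ht]
    rcases ht.1.eq_or_lt with rfl | h0
    · refine hl.hasDerivAt_of_reflect (k := 0) (e := 1) (by simpa using heven) ?_ ?_
      · have : q - 1 ≠ 0 := by linarith
        rw [hS0, Real.zero_rpow this]
        simp
      · intro x
        simpa using le_total 0 x
    rcases ht.2.eq_or_lt with rfl | h1
    · refine hu.hasDerivAt_of_reflect (k := 0) (e := -1) (fun x => ?_) (by ring) fun x => ?_
      · rw [zero_add, mul_div_cancel₀ _ two_ne_zero, ← hanti]
      · simp only [mem_Iic]
        rcases le_total x (piPQ p q / 2) with h | h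
        · exact Or.inl h
        · exact Or.inr (by linarith)
    · exact hdI t ⟨h0, h1⟩
  let P : ℝ → Prop := fun t => HasDerivAt sinpq (deriv sinpq t) t ∧
    HasDerivAt (fun s => phi p (deriv sinpq s)) (-(q / (p / (p - 1)) * phi q (sinpq t))) t
  have hPneg : ∀ t, P t → P (0 - t) := fun t ht => by
    refine ⟨(ht.1.of_reflect hodd').differentiableAt.hasDerivAt,
      (ht.2.of_reflect heven).congr_deriv ?_⟩
    rw [zero_sub, hodd, phi_neg]
    ring
  have hPref : ∀ t, P t → P (piPQ p q - t) := fun t ht => by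
    refine ⟨(ht.1.of_reflect href').differentiableAt.hasDerivAt,
      (ht.2.of_reflect hanti).congr_deriv ?_⟩
    rw [← href]
    ring
  have hPper : Function.Periodic P (piPQ p q) := fun t => propext
    ⟨fun h => by simpa using hPneg _ (hPref _ h), fun h => by
      simpa [add_comm] using hPref _ (hPneg _ h)⟩
  have hP0 : ∀ t ∈ Icc 0 (piPQ p q / 2), P t := fun t ht =>
    ⟨(hdS t ht).differentiableAt.hasDerivAt, hdP t ht⟩
  have hP : ∀ t, P t := fun t => by
    obtain ⟨y, hy, h⟩ := hPper.exists_mem_Ico hpi t (-(piPQ p q / 2))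
    rw [h]
    rcases le_total 0 y with h0 | h0
    · exact hP0 y ⟨h0, by linarith [hy.2]⟩
    · simpa using hPneg (-y) (hP0 (-y) ⟨by linarith, by linarith [hy.1]⟩)
  exact ⟨deriv sinpq, fun t => (hP t).1, fun t => (hP t).2⟩
end

section
/- Let p > 1, q > 0 and k ∈ [0,1), and let sn_{pq}(·,k) : [0, K_{pq}(k)] → [0,1] be the inverse of arcsn_{pq}(·,k). Then sn_{pq}(·,k) is differentiable on the open interval (0, K_{pq}(k)) and its derivative there equals cn_{pq}(t)·dn_{pq}(t), where cn_{pq}(t) = (1 − sn_{pq}(t,k)^q)^{1/p} and dn_{pq}(t) = (1 − k^q·sn_{pq}(t,k)^q)^{1/p}. -/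
open Real Set Filter MeasureTheory

theorem min_one_mul_one_sub_le_one_sub_rpow {q s : ℝ} (hq : 0 ≤ q) (hs0 : 0 ≤ s) (hs1 : s ≤ 1) :
    min 1 q * (1 - s) ≤ 1 - s ^ q := by
  rcases le_total q 1 with h | h
  · have := rpow_one_add_le_one_add_mul_self (s := s - 1) (by linarith) hq h
    rw [min_eq_right h]
    rw [add_sub_cancel] at this
    linarith
  · have := rpow_le_rpow_of_exponent_ge' hs0 hs1 zero_le_one h
    rw [min_eq_left h]
    rw [rpow_one] at this
    linarith

theorem one_sub_rpow_mul_le_one_sub_mul_rpow {q k s : ℝ} (hq : 0 ≤ q) (hk : 0 ≤ k)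
    (hs0 : 0 ≤ s) (hs1 : s ≤ 1) : 1 - k ^ q ≤ 1 - k ^ q * s ^ q := by
  have := mul_le_of_le_one_right (rpow_nonneg hk q) (rpow_le_one hs0 hs1 hq)
  linarith

theorem measurable_arcsnPQ_integrand (p q k : ℝ) :
    Measurable fun s : ℝ => ((1 - s ^ q) * (1 - k ^ q * s ^ q)) ^ (-(1 / p)) := by
  fun_prop

theorem intervalIntegrable_arcsnPQ_integrand {p q k : ℝ} (hp : 1 < p) (hq : 0 < q)
    (hk : k ∈ Ico (0 : ℝ) 1) :
    IntervalIntegrable (fun s : ℝ => ((1 - s ^ q) * (1 - k ^ q * s ^ q)) ^ (-(1 / p)))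
      volume 0 1 := by
  have hp' : 1 / p < 1 := by rw [div_lt_one (by linarith)]; exact hp
  have hp0 : 0 < 1 / p := by positivity
  have hkq : 0 < 1 - k ^ q := sub_pos.2 (rpow_lt_one hk.1 hk.2 hq)
  have hc : 0 < min 1 q * (1 - k ^ q) := mul_pos (lt_min one_pos hq) hkq
  have hdom : IntervalIntegrable
      (fun s : ℝ => (min 1 q * (1 - k ^ q)) ^ (-(1 / p)) * (1 - s) ^ (-(1 / p))) volume 0 1 := by
    have h := (intervalIntegral.intervalIntegrable_rpow' (a := 1) (b := 0) (r := -(1 / p))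
      (by linarith)).comp_sub_left 1
    rw [sub_self, sub_zero] at h
    exact h.const_mul _
  refine hdom.mono_fun' (measurable_arcsnPQ_integrand p q k).aestronglyMeasurable ?_
  rw [uIoc_of_le zero_le_one, ← restrict_Ioo_eq_restrict_Ioc]
  refine (ae_restrict_iff' measurableSet_Ioo).2 (Eventually.of_forall fun s hs => ?_)
  have hs1 : 0 < 1 - s := sub_pos.2 hs.2
  have hle : min 1 q * (1 - k ^ q) * (1 - s) ≤ (1 - s ^ q) * (1 - k ^ q * s ^ q) := by
    rw [mul_right_comm]
    have h := min_one_mul_one_sub_le_one_sub_rpow hq.le hs.1.le hs.2.le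
    have hpos : 0 < min 1 q * (1 - s) := mul_pos (lt_min one_pos hq) hs1
    exact mul_le_mul h (one_sub_rpow_mul_le_one_sub_mul_rpow hq.le hk.1 hs.1.le hs.2.le)
      hkq.le (hpos.le.trans h)
  have hpos : 0 < min 1 q * (1 - k ^ q) * (1 - s) := mul_pos hc hs1
  dsimp only
  rw [norm_of_nonneg (rpow_nonneg (hpos.le.trans hle) _), ← mul_rpow hc.le hs1.le]
  exact rpow_le_rpow_of_nonpos hpos hle (by linarith)

theorem continuousOn_arcsnPQ {p q k : ℝ} (hp : 1 < p) (hq : 0 < q) (hk : k ∈ Ico (0 : ℝ) 1) :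
    ContinuousOn (arcsnPQ p q k) (Icc 0 1) := by
  have h := intervalIntegral.continuousOn_primitive_interval'
    (intervalIntegrable_arcsnPQ_integrand hp hq hk) left_mem_uIcc
  rwa [uIcc_of_le zero_le_one] at h

theorem hasStrictDerivAt_arcsnPQ {p q k σ : ℝ} (hp : 1 < p) (hq : 0 < q)
    (hk : k ∈ Ico (0 : ℝ) 1) (hσ : σ ∈ Ioo (0 : ℝ) 1) :
    HasStrictDerivAt (arcsnPQ p q k)
      (((1 - σ ^ q) * (1 - k ^ q * σ ^ q)) ^ (-(1 / p))) σ := by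
  have hσq : 0 < 1 - σ ^ q := sub_pos.2 (rpow_lt_one hσ.1.le hσ.2 hq)
  have hkσ : 0 < 1 - k ^ q * σ ^ q :=
    (sub_pos.2 (rpow_lt_one hk.1 hk.2 hq)).trans_le
      (one_sub_rpow_mul_le_one_sub_mul_rpow hq.le hk.1 hσ.1.le hσ.2.le)
  have hpow : ContinuousAt (fun s : ℝ => s ^ q) σ := continuousAt_rpow_const _ _ (Or.inr hq.le)
  refine intervalIntegral.integral_hasStrictDerivAt_right
    ((intervalIntegrable_arcsnPQ_integrand hp hq hk).mono_set ?_)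
    (measurable_arcsnPQ_integrand p q k).stronglyMeasurable.stronglyMeasurableAtFilter ?_
  · rw [uIcc_of_le hσ.1.le, uIcc_of_le zero_le_one]
    exact Icc_subset_Icc_right hσ.2.le
  · exact ((continuousAt_const.sub hpow).mul
      (continuousAt_const.sub (continuousAt_const.mul hpow))).rpow_const
      (Or.inl (mul_pos hσq hkσ).ne')

theorem stmt8 (p q k : ℝ) (hp : 1 < p) (hq : 0 < q) (hk : k ∈ Ico (0:ℝ) 1)
    (sn : ℝ → ℝ)
    (hinv : ∀ σ ∈ Icc (0:ℝ) 1, sn (arcsnPQ p q k σ) = σ) :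
    ∀ t ∈ Ioo 0 (Kpq p q k),
      HasDerivAt sn ((1 - sn t ^ q) ^ (1 / p) * (1 - k ^ q * sn t ^ q) ^ (1 / p)) t := by
  intro t ht
  have h0 : arcsnPQ p q k 0 = 0 := intervalIntegral.integral_same
  obtain ⟨σ, hσ, rfl⟩ : t ∈ arcsnPQ p q k '' Ioo 0 1 :=
    intermediate_value_Ioo zero_le_one (continuousOn_arcsnPQ hp hq hk) (by rwa [h0])
  rw [hinv σ (Ioo_subset_Icc_self hσ)]
  have hσq : 0 < 1 - σ ^ q := sub_pos.2 (rpow_lt_one hσ.1.le hσ.2 hq)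
  have hkσ : 0 < 1 - k ^ q * σ ^ q :=
    (sub_pos.2 (rpow_lt_one hk.1 hk.2 hq)).trans_le
      (one_sub_rpow_mul_le_one_sub_mul_rpow hq.le hk.1 hσ.1.le hσ.2.le)
  have hd := (hasStrictDerivAt_arcsnPQ hp hq hk hσ).to_local_left_inverse
    (rpow_pos_of_pos (mul_pos hσq hkσ) _).ne'
    (g := sn) (by
      filter_upwards [Ioo_mem_nhds hσ.1 hσ.2] with x hx
      exact hinv x (Ioo_subset_Icc_self hx))
  rw [rpow_neg (mul_pos hσq hkσ).le, inv_inv, mul_rpow hσq.le hkσ.le] at hd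
  exact hd.hasDerivAt
end
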